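/- For all real s with 0 < s < 1, we have s < ζ(s) - ψ(1-s). -/

import Mathlib

/-- The real digamma function `ψ = Γ'/Γ`. -/
noncomputable def digammaReal (x : ℝ) : ℝ := deriv Real.Gamma x / Real.Gamma x

open Filter Topology Set

theorem Real.log_one_add_le_trapezoid {t : ℝ} (ht : 0 ≤ t) :
    Real.log (1 + t) ≤ (t + t / (1 + t)) / 2 - (t ^ 2 - t ^ 2 / (1 + t) ^ 2) / 12
      + (t ^ 4 - t ^ 4 / (1 + t) ^ 4) / 120 := by
  let f : ℝ → ℝ := fun t ↦ (t + t / (1 + t)) / 2 - (t ^ 2 - t ^ 2 / (1 + t) ^ 2) / 12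
      + (t ^ 4 - t ^ 4 / (1 + t) ^ 4) / 120 - Real.log (1 + t)
  have hder : ∀ x : ℝ, 0 ≤ x →
      HasDerivAt f (x ^ 6 * (5 + 5 * x + x ^ 2) / (30 * (1 + x) ^ 5)) x := by
    intro x hx
    have h1 : (1 + x) ≠ 0 := by positivity
    have hu : HasDerivAt (fun y : ℝ ↦ 1 + y) 1 x := (hasDerivAt_id x).const_add 1
    have hi : HasDerivAt (fun y : ℝ ↦ y) 1 x := hasDerivAt_id x
    have := (((hi.add (hi.div hu h1)).div_const 2).sub
      (((hi.pow 2).sub ((hi.pow 2).div (hu.pow 2) (pow_ne_zero 2 h1))).div_const 12)).add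
      (((hi.pow 4).sub ((hi.pow 4).div (hu.pow 4) (pow_ne_zero 4 h1))).div_const 120)
      |>.sub (hu.log h1)
    refine this.congr_deriv ?_
    simp
    field_simp
    ring
  have hmono : MonotoneOn f (Ici 0) := by
    refine monotoneOn_of_deriv_nonneg (convex_Ici 0)
      (fun x hx ↦ (hder x hx).continuousAt.continuousWithinAt)
      (fun x hx ↦ ?_) (fun x hx ↦ ?_)
    · rw [interior_Ici] at hx
      exact (hder x hx.le).differentiableAt.differentiableWithinAt
    · rw [interior_Ici] at hx
      have hx' : 0 < x := hx
      rw [(hder x hx.le).deriv]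
      positivity
  have := hmono (show (0 : ℝ) ∈ Ici 0 by simp) (show t ∈ Ici 0 from ht) ht
  simp only [f] at this
  norm_num at this
  linarith

theorem hasDerivAt_log_Gamma {x : ℝ} (hx : 0 < x) :
    HasDerivAt (fun y ↦ Real.log (Real.Gamma y)) (digammaReal x) x :=
  (Real.differentiableAt_Gamma fun m ↦ by
    have : (0 : ℝ) ≤ m := m.cast_nonneg
    linarith).hasDerivAt.log (Real.Gamma_pos_of_pos hx).ne'

theorem Real.log_Gamma_add_one {x : ℝ} (hx : 0 < x) :
    Real.log (Real.Gamma (x + 1)) = Real.log x + Real.log (Real.Gamma x) := by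
  rw [Real.Gamma_add_one hx.ne', Real.log_mul hx.ne' (Real.Gamma_pos_of_pos hx).ne']

theorem digammaReal_add_one {x : ℝ} (hx : 0 < x) :
    digammaReal (x + 1) = digammaReal x + 1 / x := by
  have h1 := (hasDerivAt_log_Gamma (x := x + 1) (by linarith)).comp_add_const x 1
  have h2 := (Real.hasDerivAt_log hx.ne').add (hasDerivAt_log_Gamma hx)
  have h3 : (fun y ↦ Real.log (Real.Gamma (y + 1))) =ᶠ[𝓝 x]
      (Real.log + fun y ↦ Real.log (Real.Gamma y)) := by
    filter_upwards [lt_mem_nhds hx] with y hy using Real.log_Gamma_add_one hy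
  rw [h1.unique (h2.congr_of_eventuallyEq h3), one_div, add_comm]

theorem digammaReal_le_log {x : ℝ} (hx : 0 < x) : digammaReal x ≤ Real.log x := by
  have := Real.convexOn_log_Gamma.le_slope_of_hasDerivAt (x := x) (y := x + 1) hx
    (show (0 : ℝ) < x + 1 by linarith) (by linarith) (hasDerivAt_log_Gamma hx)
  simpa [slope_def_field, Real.log_Gamma_add_one hx] using this

theorem digammaReal_le {x : ℝ} (hx : 0 < x) :
    digammaReal x ≤ Real.log x - 1 / (2 * x) - 1 / (12 * x ^ 2) + 1 / (120 * x ^ 4) := by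
  let r : ℝ → ℝ := fun x ↦ - 1 / (2 * x) - 1 / (12 * x ^ 2) + 1 / (120 * x ^ 4)
  let f : ℝ → ℝ := fun x ↦ Real.log x + r x - digammaReal x
  have hstep : ∀ y : ℝ, 0 < y → f (y + 1) ≤ f y := by
    intro y hy
    have h := Real.log_one_add_le_trapezoid (t := 1 / y) (by positivity)
    have e : 1 + 1 / y = (y + 1) / y := by field_simp
    rw [e, Real.log_div (by positivity) hy.ne'] at h
    have e2 : (1 / y + 1 / y / ((y + 1) / y)) / 2 - ((1 / y) ^ 2 - (1 / y) ^ 2 / ((y + 1) / y) ^ 2) / 12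
      + ((1 / y) ^ 4 - (1 / y) ^ 4 / ((y + 1) / y) ^ 4) / 120 = r y - r (y + 1) + 1 / y := by
      simp only [r]
      field_simp
      ring
    simp only [f, digammaReal_add_one hy]
    linarith
  have hn : ∀ n : ℕ, f (x + n) ≤ f x := by
    intro n
    induction n with
    | zero => simp
    | succ n ih =>
      have := hstep (x + n) (by positivity)
      push_cast
      rw [← add_assoc]
      exact this.trans ih
  have hlim : Tendsto (fun n : ℕ ↦ r (x + n)) atTop (𝓝 0) := by
    have h1 : Tendsto (fun n : ℕ ↦ x + (n : ℝ)) atTop atTop :=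
      tendsto_atTop_add_const_left _ _ tendsto_natCast_atTop_atTop
    have h2 : Tendsto (fun n : ℕ ↦ (x + (n : ℝ))⁻¹) atTop (𝓝 0) := h1.inv_tendsto_atTop
    have h3 := ((h2.const_mul (-1 / 2)).sub ((h2.pow 2).const_mul (1 / 12))).add
      ((h2.pow 4).const_mul (1 / 120))
    norm_num at h3
    refine h3.congr fun n ↦ ?_
    simp only [r]
    have : x + n ≠ 0 := by positivity
    field_simp
  have h0 : 0 ≤ f x := by
    refine le_of_tendsto hlim (Eventually.of_forall fun n ↦ ?_)
    have := digammaReal_le_log (x := x + n) (by positivity)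
    have := hn n
    simp only [f] at this ⊢
    linarith
  simp only [f, r] at h0
  have : -1 / (2 * x) = - (1 / (2 * x)) := by ring
  linarith

theorem one_add_rpow_mul_le {s t : ℝ} (hs : 0 < s) (hs1 : s < 1) (ht : 0 ≤ t) (ht1 : t ≤ 1) :
    ((1 + t) ^ 4 - (1 - s) * (t * (1 + t) ^ 3 / 2 + s * t ^ 2 * (1 + t) ^ 2 / 12
        - s * (s + 1) * (s + 2) / 720 * t ^ 4)) * (1 + t) ^ (-(s + 3)) ≤
      1 + (1 - s) * (t / 2 - s * t ^ 2 / 12 + s * (s + 1) * (s + 2) / 720 * t ^ 4) := by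
  let c : ℝ := s * (s + 1) * (s + 2) / 720
  let P : ℝ → ℝ := fun t ↦ 1 + (1 - s) * (t / 2 - s * t ^ 2 / 12 + c * t ^ 4)
  let Q : ℝ → ℝ := fun t ↦
    (1 + t) ^ 4 - (1 - s) * (t * (1 + t) ^ 3 / 2 + s * t ^ 2 * (1 + t) ^ 2 / 12 - c * t ^ 4)
  let P' : ℝ → ℝ := fun t ↦ (1 - s) * (1 / 2 - s * t / 6 + 4 * c * t ^ 3)
  let Q' : ℝ → ℝ := fun t ↦
    4 * (1 + t) ^ 3 - (1 - s) * ((1 + t) ^ 3 / 2 + 3 * t * (1 + t) ^ 2 / 2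
      + s * t * (1 + t) ^ 2 / 6 + s * t ^ 2 * (1 + t) / 6 - 4 * c * t ^ 3)
  have hc : 0 < c := by positivity
  have hP : ∀ x ∈ Icc (0 : ℝ) 1, 0 < P x := by
    rintro x ⟨h0, h1⟩
    have : s * x ^ 2 ≤ x := by nlinarith
    have h2 : 0 ≤ x / 2 - s * x ^ 2 / 12 + c * x ^ 4 := by
      have : 0 ≤ c * x ^ 4 := by positivity
      linarith
    have := mul_nonneg (sub_nonneg.2 hs1.le) h2
    simp only [P]
    linarith
  have hPd : ∀ x, HasDerivAt P (P' x) x := by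
    intro x
    have hi : HasDerivAt (fun y : ℝ ↦ y) 1 x := hasDerivAt_id x
    refine (((((hi.div_const 2).sub (((hi.pow 2).const_mul s).div_const 12)).add
      ((hi.pow 4).const_mul c)).const_mul (1 - s)).const_add 1).congr_deriv ?_
    simp only [P']
    push_cast
    ring
  have hu : ∀ x : ℝ, HasDerivAt (fun y : ℝ ↦ 1 + y) 1 x := fun x ↦ (hasDerivAt_id x).const_add 1
  have hQd : ∀ x, HasDerivAt Q (Q' x) x := by
    intro x
    have hi : HasDerivAt (fun y : ℝ ↦ y) 1 x := hasDerivAt_id x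
    refine (((hu x).pow 4).sub (((((hi.mul ((hu x).pow 3)).div_const 2).add
      ((((hi.pow 2).const_mul s).mul ((hu x).pow 2)).div_const 12)).sub
      ((hi.pow 4).const_mul c)).const_mul (1 - s))).congr_deriv ?_
    simp only [Q', Pi.pow_apply]
    push_cast
    ring
  have hkey : ∀ x ∈ Icc (0 : ℝ) 1,
      (Q' x * (1 + x) - (s + 3) * Q x) * P x - Q x * P' x * (1 + x) ≤ 0 := by
    rintro x ⟨h0, h1⟩
    have e : (Q' x * (1 + x) - (s + 3) * Q x) * P x - Q x * P' x * (1 + x) =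
        - (s * (1 - s) * x ^ 6 * ((1 + x) * (20 * (120 + 274 * s + 225 * s ^ 2 + 85 * s ^ 3
          + 15 * s ^ 4 + s ^ 5)) + x ^ 2 * (2160 + 5772 * s + 5848 * s ^ 2 + 2831 * s ^ 3
          + 640 * s ^ 4 + 38 * s ^ 5 - 8 * s ^ 6 - s ^ 7) / 6) / 86400) := by
      simp only [P, Q, P', Q', c]
      ring
    rw [e, neg_nonpos]
    have hs6 : s ^ 6 ≤ 1 := pow_le_one₀ hs.le hs1.le
    have hs7 : s ^ 7 ≤ 1 := pow_le_one₀ hs.le hs1.le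
    have h2 : 0 ≤ 2160 + 5772 * s + 5848 * s ^ 2 + 2831 * s ^ 3
          + 640 * s ^ 4 + 38 * s ^ 5 - 8 * s ^ 6 - s ^ 7 := by
      have : 0 ≤ 5772 * s + 5848 * s ^ 2 + 2831 * s ^ 3 + 640 * s ^ 4 + 38 * s ^ 5 := by
        positivity
      linarith
    have h3 : 0 < 1 - s := by linarith
    positivity
  let W : ℝ → ℝ := fun x ↦ Q x * (1 + x) ^ (-(s + 3)) / P x
  have hW : ∀ x ∈ Icc (0 : ℝ) 1, HasDerivAt W
      ((1 + x) ^ (-(s + 3) - 1) * ((Q' x * (1 + x) - (s + 3) * Q x) * P x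
        - Q x * P' x * (1 + x)) / P x ^ 2) x := by
    intro x hx
    have h1 : 0 < 1 + x := by linarith [hx.1]
    refine (((hQd x).mul ((hu x).rpow_const (p := -(s + 3)) (Or.inl h1.ne'))).div (hPd x)
      (hP x hx).ne').congr_deriv ?_
    have e : (1 + x) ^ (-(s + 3)) = (1 + x) ^ (-(s + 3) - 1) * (1 + x) := by
      rw [← Real.rpow_add_one h1.ne']
      congr 1
      ring
    simp only [Pi.mul_apply]
    rw [e]
    ring
  have hanti : AntitoneOn W (Icc 0 1) := by
    refine antitoneOn_of_deriv_nonpos (convex_Icc 0 1)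
      (fun x hx ↦ (hW x hx).continuousAt.continuousWithinAt)
      (fun x hx ↦ (hW x (interior_subset hx)).differentiableAt.differentiableWithinAt)
      (fun x hx ↦ ?_)
    have hx' := interior_subset hx
    rw [(hW x hx').deriv]
    have h1 : 0 ≤ 1 + x := by linarith [hx'.1]
    exact div_nonpos_of_nonpos_of_nonneg
      (mul_nonpos_of_nonneg_of_nonpos (Real.rpow_nonneg h1 _) (hkey x hx')) (sq_nonneg _)
  have h := hanti (show (0 : ℝ) ∈ Icc 0 1 by simp) ⟨ht, ht1⟩ ht
  have h0 : W 0 = 1 := by simp [W, P, Q]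
  rw [h0, div_le_one (hP t ⟨ht, ht1⟩)] at h
  exact h

/-- The increment over `[a, a + 1]` of the corrected partial sums of the zeta function,
normalised so as to be entire in `s`. -/
noncomputable def zetaIncrement (a : ℝ) (s : ℂ) : ℂ :=
  (1 - s) * (a : ℂ) ^ (-s) - ((a + 1 : ℝ) : ℂ) ^ (1 - s) + (a : ℂ) ^ (1 - s)

theorem differentiable_zetaIncrement {a : ℝ} (ha : 0 < a) :
    Differentiable ℂ (zetaIncrement a) := by
  have h1 : (a : ℂ) ≠ 0 := by exact_mod_cast ha.ne'
  have h2 : ((a + 1 : ℝ) : ℂ) ≠ 0 := by exact_mod_cast (by positivity : a + 1 ≠ 0)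
  intro s
  unfold zetaIncrement
  have e1 : DifferentiableAt ℂ (fun s : ℂ ↦ (a : ℂ) ^ (-s)) s :=
    DifferentiableAt.const_cpow (by fun_prop) (Or.inl h1)
  have e2 : DifferentiableAt ℂ (fun s : ℂ ↦ (a : ℂ) ^ (1 - s)) s :=
    DifferentiableAt.const_cpow (by fun_prop) (Or.inl h1)
  have e3 : DifferentiableAt ℂ (fun s : ℂ ↦ ((a + 1 : ℝ) : ℂ) ^ (1 - s)) s :=
    DifferentiableAt.const_cpow (by fun_prop) (Or.inl h2)
  fun_prop

theorem hasDerivAt_ofReal_cpow_of_pos {x : ℝ} (hx : 0 < x) (s : ℂ) :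
    HasDerivAt (fun y : ℝ ↦ (y : ℂ) ^ s) (s * (x : ℂ) ^ (s - 1)) x := by
  have := (hasDerivAt_id (x : ℂ)).cpow_const (c := s)
    (Or.inl (by simpa using hx))
  simpa using this.comp_ofReal

theorem norm_zetaIncrement_le {a : ℝ} (ha : 0 < a) {s : ℂ} (hs : 0 < s.re) :
    ‖zetaIncrement a s‖ ≤ ‖1 - s‖ * ‖s‖ * a ^ (-s.re - 1) := by
  have h1 : ∀ x ∈ Icc a (a + 1), ‖(x : ℂ) ^ (-s) - (a : ℂ) ^ (-s)‖ ≤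
      ‖s‖ * a ^ (-s.re - 1) * (x - a) := by
    refine norm_image_sub_le_of_norm_deriv_le_segment'
      (f' := fun x ↦ -s * (x : ℂ) ^ (-s - 1)) (fun x hx ↦ ?_) (fun x hx ↦ ?_)
    · exact (hasDerivAt_ofReal_cpow_of_pos (ha.trans_le hx.1) _).hasDerivWithinAt
    · have hx0 : 0 < x := ha.trans_le hx.1
      rw [norm_mul, norm_neg, Complex.norm_cpow_eq_rpow_re_of_pos hx0]
      simp only [Complex.sub_re, Complex.neg_re, Complex.one_re]
      gcongr ?_ * ?_
      exact Real.rpow_le_rpow_of_nonpos ha hx.1 (by linarith)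
  have h2 := norm_image_sub_le_of_norm_deriv_le_segment'
      (f := fun x : ℝ ↦ (1 - s) * (a : ℂ) ^ (-s) * x - (x : ℂ) ^ (1 - s))
      (f' := fun x ↦ (1 - s) * (a : ℂ) ^ (-s) - (1 - s) * (x : ℂ) ^ (-s))
      (a := a) (b := a + 1) (C := ‖1 - s‖ * ‖s‖ * a ^ (-s.re - 1))
      (fun x hx ↦ ?_) (fun x hx ↦ ?_) (a + 1) (by simp)
  · rw [add_sub_cancel_left, mul_one] at h2
    refine (congrArg norm ?_).trans_le h2
    rw [zetaIncrement]
    push_cast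
    ring
  · refine HasDerivAt.hasDerivWithinAt ?_
    have e := hasDerivAt_ofReal_cpow_of_pos (ha.trans_le hx.1) (1 - s)
    rw [show 1 - s - 1 = -s by ring] at e
    have e2 : HasDerivAt (fun x : ℝ ↦ (1 - s) * (a : ℂ) ^ (-s) * x) ((1 - s) * (a : ℂ) ^ (-s)) x := by
      simpa using (hasDerivAt_id (x : ℂ)).comp_ofReal.const_mul ((1 - s) * (a : ℂ) ^ (-s))
    exact e2.sub e
  · rw [← mul_sub, norm_mul, norm_sub_rev ((a : ℂ) ^ (-s)), mul_assoc]
    gcongr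
    refine (h1 x ⟨hx.1, hx.2.le⟩).trans ?_
    have : 0 ≤ ‖s‖ * a ^ (-s.re - 1) := by positivity
    nlinarith [hx.2]

theorem hasSum_zetaIncrement_of_one_lt_re {s : ℂ} (hs : 1 < s.re) :
    HasSum (fun n : ℕ ↦ zetaIncrement (n + 1) s) (1 - (s - 1) * riemannZeta s) := by
  have hsum : Summable fun n : ℕ ↦ 1 / ((n : ℂ) + 1) ^ s := by
    have := (summable_nat_add_iff 1).2 (Complex.summable_one_div_nat_cpow.2 hs)
    simpa using this
  have h1 : HasSum (fun n : ℕ ↦ 1 / ((n : ℂ) + 1) ^ s) (riemannZeta s) := by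
    rw [zeta_eq_tsum_one_div_nat_add_one_cpow hs]
    exact hsum.hasSum
  have hlim : Tendsto (fun n : ℕ ↦ ((n : ℂ) + 1) ^ (1 - s)) atTop (𝓝 0) := by
    rw [tendsto_zero_iff_norm_tendsto_zero]
    have e : Tendsto (fun n : ℕ ↦ ((n : ℝ) + 1) ^ (-(s.re - 1))) atTop (𝓝 0) :=
      (tendsto_rpow_neg_atTop (by linarith)).comp
        (tendsto_atTop_add_const_right _ _ tendsto_natCast_atTop_atTop)
    refine e.congr fun n ↦ ?_
    have := Complex.norm_cpow_eq_rpow_re_of_pos (x := (n : ℝ) + 1) (by positivity) (1 - s)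
    push_cast at this
    rw [this]
    simp
  have hnorm : Summable fun n : ℕ ↦ ‖zetaIncrement (n + 1) s‖ := by
    have e : Summable fun n : ℕ ↦ ((n : ℝ) + 1) ^ (-s.re - 1) := by
      have := (summable_nat_add_iff 1).2 (Real.summable_nat_rpow (p := -s.re - 1) |>.2 (by linarith))
      simpa using this
    exact Summable.of_nonneg_of_le (fun _ ↦ norm_nonneg _)
      (fun n ↦ norm_zetaIncrement_le (by positivity) (by linarith)) (e.mul_left _)
  rw [(hnorm.of_norm).hasSum_iff_tendsto_nat]
  have h2 := (h1.tendsto_sum_nat.const_mul (1 - s)).sub (hlim.sub_const 1)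
  rw [show (1 - s) * riemannZeta s - (0 - 1) = 1 - (s - 1) * riemannZeta s by ring] at h2
  refine h2.congr fun n ↦ ?_
  induction n with
  | zero => simp
  | succ n ih =>
    rw [Finset.sum_range_succ, Finset.sum_range_succ, ← ih, zetaIncrement, Complex.cpow_neg]
    push_cast
    ring

theorem hasSum_zetaIncrement {s : ℂ} (hs : 0 < s.re) (hs1 : s ≠ 1) :
    HasSum (fun n : ℕ ↦ zetaIncrement (n + 1) s) (1 - (s - 1) * riemannZeta s) := by
  let R : ℝ := ‖s‖ + 3
  let U : Set ℂ := {z | s.re / 2 < z.re} ∩ Metric.ball 0 R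
  have hUo : IsOpen U := (isOpen_lt continuous_const Complex.continuous_re).inter Metric.isOpen_ball
  have hUc : Convex ℝ U := (convex_halfSpace_re_gt _).inter (convex_ball _ _)
  have hle : s.re ≤ ‖s‖ := Complex.re_le_norm s
  have hsU : s ∈ U := by
    simp only [U, R, mem_inter_iff, mem_ofPred_eq, Metric.mem_ball, dist_zero_right]
    constructor <;> linarith
  have hpU : ((‖s‖ + 2 : ℝ) : ℂ) ∈ U := by
    have : 0 ≤ ‖s‖ := norm_nonneg s
    simp only [U, R, mem_inter_iff, mem_ofPred_eq, Metric.mem_ball, dist_zero_right,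
      Complex.ofReal_re, Complex.norm_real, Real.norm_eq_abs]
    rw [abs_of_nonneg (by linarith)]
    constructor <;> linarith
  have hsum : Summable fun n : ℕ ↦ (1 + R) * R * ((n : ℝ) + 1) ^ (-(s.re / 2) - 1) := by
    refine Summable.mul_left _ ?_
    have := (summable_nat_add_iff 1).2
      (Real.summable_nat_rpow (p := -(s.re / 2) - 1) |>.2 (by linarith))
    simpa using this
  have hbound : ∀ (n : ℕ), ∀ z ∈ U, ‖zetaIncrement (n + 1) z‖ ≤
      (1 + R) * R * ((n : ℝ) + 1) ^ (-(s.re / 2) - 1) := by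
    rintro n z ⟨hz1, hz2⟩
    have hz1 : s.re / 2 < z.re := hz1
    have hz2 : ‖z‖ ≤ R := (mem_ball_zero_iff.1 hz2).le
    refine (norm_zetaIncrement_le (by positivity) (by linarith)).trans ?_
    have : ‖1 - z‖ ≤ 1 + R := (norm_sub_le _ _).trans (by simpa using hz2)
    have hR : 0 ≤ R := (norm_nonneg z).trans hz2
    gcongr
    simp
  have hF : DifferentiableOn ℂ (fun z ↦ ∑' n : ℕ, zetaIncrement (n + 1) z) U :=
    Complex.differentiableOn_tsum_of_summable_norm hsum
      (fun n ↦ (differentiable_zetaIncrement (by positivity)).differentiableOn) hUo hbound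
  have hG : Differentiable ℂ (fun z ↦ 1 - riemannZeta₁ z) := by fun_prop
  have heq : ∀ z : ℂ, z ≠ 1 → 1 - riemannZeta₁ z = 1 - (z - 1) * riemannZeta z := by
    intro z hz
    rw [riemannZeta_eq_inv_sub_mul hz, mul_inv_cancel_left₀ (sub_ne_zero.2 hz)]
  have hEq : EqOn (fun z ↦ ∑' n : ℕ, zetaIncrement (n + 1) z) (fun z ↦ 1 - riemannZeta₁ z) U := by
    refine (hF.analyticOnNhd hUo).eqOn_of_preconnected_of_eventuallyEq
      (hG.differentiableOn.analyticOnNhd hUo) hUc.isPreconnected hpU ?_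
    have hmem : {z : ℂ | 1 < z.re} ∈ 𝓝 ((‖s‖ + 2 : ℝ) : ℂ) := by
      refine (isOpen_lt continuous_const Complex.continuous_re).mem_nhds ?_
      have : 0 ≤ ‖s‖ := norm_nonneg s
      simp only [mem_ofPred_eq, Complex.ofReal_re]
      linarith
    filter_upwards [hmem] with z hz
    have hz1 : z ≠ 1 := by
      rintro rfl
      simp at hz
    rw [(hasSum_zetaIncrement_of_one_lt_re hz).tsum_eq, heq z hz1]
  have hsm : Summable fun n : ℕ ↦ zetaIncrement (n + 1) s :=
    (Summable.of_nonneg_of_le (fun _ ↦ norm_nonneg _) (fun n ↦ hbound n s hsU) hsum).of_norm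
  rw [← heq s hs1, ← show _ = 1 - riemannZeta₁ s from hEq hsU]
  exact hsm.hasSum

theorem zetaIncrement_ofReal {a s : ℝ} (ha : 0 < a) :
    (zetaIncrement a s).re = (1 - s) * a ^ (-s) - (a + 1) ^ (1 - s) + a ^ (1 - s) := by
  rw [zetaIncrement, ← Complex.ofReal_neg, ← Complex.ofReal_cpow ha.le,
    ← Complex.ofReal_one, ← Complex.ofReal_sub, ← Complex.ofReal_cpow ha.le,
    ← Complex.ofReal_cpow (by positivity)]
  norm_cast

/-- The tail of the Euler–Maclaurin expansion of `ζ` at `a`. -/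
noncomputable def zetaTail (s a : ℝ) : ℝ :=
  a ^ (-s) / 2 + s / 12 * a ^ (-s - 1) - s * (s + 1) * (s + 2) / 720 * a ^ (-s - 3)

theorem zetaTail_sub_le_zetaIncrement {a s : ℝ} (ha : 1 ≤ a) (hs : 0 < s) (hs1 : s < 1) :
    (1 - s) * (zetaTail s a - zetaTail s (a + 1)) ≤ (zetaIncrement a s).re := by
  have ha0 : 0 < a := by linarith
  have h := one_add_rpow_mul_le hs hs1 (t := 1 / a) (by positivity) (by rwa [div_le_one ha0])
  rw [zetaIncrement_ofReal ha0, zetaTail, zetaTail]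
  have e (k : ℕ) (b : ℝ) (hb : 0 < b) : b ^ (-(s + 3) + k) = b ^ (-(s + 3)) * b ^ k := by
    rw [Real.rpow_add hb, Real.rpow_natCast]
  have hrw (b : ℝ) (hb : 0 < b) : b ^ (1 - s) = b ^ (-(s + 3)) * b ^ 4 ∧
      b ^ (-s) = b ^ (-(s + 3)) * b ^ 3 ∧ b ^ (-s - 1) = b ^ (-(s + 3)) * b ^ 2 ∧
      b ^ (-s - 3) = b ^ (-(s + 3)) := by
    refine ⟨?_, ?_, ?_, ?_⟩
    · rw [← e 4 b hb]; congr 1; push_cast; ring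
    · rw [← e 3 b hb]; congr 1; push_cast; ring
    · rw [← e 2 b hb]; congr 1; push_cast; ring
    · congr 1; ring
  obtain ⟨e1, e2, e3, e4⟩ := hrw a ha0
  obtain ⟨f1, f2, f3, f4⟩ := hrw (a + 1) (by positivity)
  rw [e1, e2, e3, e4, f1, f2, f3, f4]
  rw [show 1 + 1 / a = (a + 1) / a by field_simp, Real.div_rpow (by positivity) ha0.le] at h
  have hA : 0 < a ^ (-(s + 3)) := by positivity
  set A := a ^ (-(s + 3))
  set B := (a + 1) ^ (-(s + 3))
  have h' := mul_le_mul_of_nonneg_right h (show 0 ≤ A * a ^ 4 by positivity)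
  have hl : (((a + 1) / a) ^ 4 - (1 - s) * (1 / a * ((a + 1) / a) ^ 3 / 2
      + s * (1 / a) ^ 2 * ((a + 1) / a) ^ 2 / 12
      - s * (s + 1) * (s + 2) / 720 * (1 / a) ^ 4)) * (B / A) * (A * a ^ 4) =
      B * ((a + 1) ^ 4 - (1 - s) * ((a + 1) ^ 3 / 2 + s * (a + 1) ^ 2 / 12
      - s * (s + 1) * (s + 2) / 720)) := by
    field_simp
  have hr : (1 + (1 - s) * (1 / a / 2 - s * (1 / a) ^ 2 / 12
      + s * (s + 1) * (s + 2) / 720 * (1 / a) ^ 4)) * (A * a ^ 4) =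
      A * (a ^ 4 + (1 - s) * (a ^ 3 / 2 - s * a ^ 2 / 12 + s * (s + 1) * (s + 2) / 720)) := by
    field_simp
  rw [hl, hr] at h'
  linarith

theorem tendsto_zetaTail {s : ℝ} (hs : 0 < s) : Tendsto (zetaTail s) atTop (𝓝 0) := by
  have h1 := tendsto_rpow_neg_atTop hs
  have h2 := tendsto_rpow_neg_atTop (show 0 < s + 1 by linarith)
  have h3 := tendsto_rpow_neg_atTop (show 0 < s + 3 by linarith)
  have := ((h1.div_const 2).add (h2.const_mul (s / 12))).sub
    (h3.const_mul (s * (s + 1) * (s + 2) / 720))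
  simp only [zero_div, mul_zero, add_zero, sub_zero] at this
  refine this.congr fun x ↦ ?_
  rw [zetaTail, neg_add', neg_add']

theorem le_riemannZeta_re {s : ℝ} (hs : 0 < s) (hs1 : s < 1) :
    1 / 2 + s / 12 - s * (s + 1) * (s + 2) / 720 - 1 / (1 - s) ≤ (riemannZeta s).re := by
  have hpos : 0 < 1 - s := by linarith
  have h := Complex.hasSum_re (hasSum_zetaIncrement (s := s) (by simpa using hs)
    (by exact_mod_cast hs1.ne))
  have hre : (1 - ((s : ℂ) - 1) * riemannZeta s).re = 1 + (1 - s) * (riemannZeta s).re := by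
    simp
    ring
  rw [hre] at h
  have hpart : ∀ N : ℕ, (1 - s) * (zetaTail s 1 - zetaTail s (N + 1)) ≤
      ∑ n ∈ Finset.range N, (zetaIncrement (n + 1) s).re := by
    intro N
    induction N with
    | zero => simp
    | succ N ih =>
      rw [Finset.sum_range_succ]
      have := zetaTail_sub_le_zetaIncrement (a := N + 1) (by simp) hs hs1
      push_cast at this ⊢
      linarith
  have hl : Tendsto (fun N : ℕ ↦ (1 - s) * (zetaTail s 1 - zetaTail s (N + 1))) atTop
      (𝓝 ((1 - s) * (zetaTail s 1 - 0))) :=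
    (((tendsto_zetaTail hs).comp (tendsto_atTop_add_const_right _ _
      tendsto_natCast_atTop_atTop)).const_sub _).const_mul _
  have hle := le_of_tendsto_of_tendsto' hl h.tendsto_sum_nat (fun N ↦ by exact_mod_cast hpart N)
  have h1 : zetaTail s 1 = 1 / 2 + s / 12 - s * (s + 1) * (s + 2) / 720 := by simp [zetaTail]
  rw [h1] at hle
  have : (1 - s) * (1 / (1 - s)) = 1 := mul_one_div_cancel hpos.ne'
  refine le_of_mul_le_mul_left ?_ hpos
  linarith

theorem digamma_zeta_gap_poly_pos {t : ℝ} (h0 : 0 ≤ t) (h1 : t ≤ 1) :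
    0 < 108 - 73 * t - 538 * t ^ 2 + 19 * t ^ 3 + 846 * t ^ 4 + 509 * t ^ 5 + 22 * t ^ 6
      - 23 * t ^ 7 - 6 * t ^ 8 := by
  have h4 : t ^ 4 ≤ 1 := pow_le_one₀ h0 h1
  have h5 : t ^ 5 ≤ 1 := pow_le_one₀ h0 h1
  have h6 : t ^ 6 ≤ 1 := pow_le_one₀ h0 h1
  have hq : 0 ≤ 11901/32 + 19991/16 * t + 10865/8 * t ^ 2 + 2043/4 * t ^ 3 - 11/2 * t ^ 4
      - 29 * t ^ 5 - 6 * t ^ 6 := by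
    have : 0 ≤ 19991/16 * t + 10865/8 * t ^ 2 + 2043/4 * t ^ 3 := by positivity
    linarith
  have := mul_nonneg (sq_nonneg (t - 1 / 2)) hq
  linear_combination (exp := 1) this + (861/64) * h1

theorem stmt_18 (s : ℝ) (hs : 0 < s) (hs1 : s < 1) :
    s < (riemannZeta s).re - digammaReal (1 - s) := by
  have hz := le_riemannZeta_re hs hs1
  have hstep := digammaReal_add_one (x := 1 - s) (by linarith)
  obtain ⟨t, rfl⟩ : ∃ t, s = 1 - t := ⟨1 - s, by ring⟩
  have ht : 0 < t := by linarith
  have hψ := digammaReal_le (x := 1 + t) (by linarith)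
  have hlog := Real.log_one_add_le_trapezoid ht.le
  rw [sub_sub_cancel] at hz hstep ⊢
  rw [add_comm t 1] at hstep
  have hpoly := digamma_zeta_gap_poly_pos ht.le (by linarith)
  have hgap : 0 < 1 / 2 + (1 - t) / 12 - (1 - t) * (1 - t + 1) * (1 - t + 2) / 720 - (1 - t)
      - ((t + t / (1 + t)) / 2 - (t ^ 2 - t ^ 2 / (1 + t) ^ 2) / 12
        + (t ^ 4 - t ^ 4 / (1 + t) ^ 4) / 120)
      + 1 / (2 * (1 + t)) + 1 / (12 * (1 + t) ^ 2) - 1 / (120 * (1 + t) ^ 4) := by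
    have h1 : 1 + t ≠ 0 := by positivity
    refine (div_pos hpoly (show 0 < 720 * (1 + t) ^ 4 by positivity)).trans_eq ?_
    field_simp
    ring
  linarith
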